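/- Let n ≥ 1, let (π, V) be a representation of G on a complex vector space (a group homomorphism π: G → GL(V)), and let v ∈ V be fixed by K_n. Define Tv = Σ_k π(k·ζ)v, where k runs over the complete set of representatives for K_n/(K_n ∩ ζ·K_n·ζ^{-1}) consisting of the elements t_n·u(y, z√ε − yȳ/2) (y over o_E/p_E, z over p_F^{1−n}/p_F^{2−n}) and u(a, b√ε − aā/2) (a over o_E/p_E, b over p_F^{−n}/p_F^{2−n}), and define v' = Σ_{y ∈ p_E^{n−1}/p_E^n} Σ_{z ∈ p_F^{n−1}/p_F^n} π(û(y, z√ε − yȳ/2))v. Then Tv = π(ζ^{-1})v' + Σ_{a ∈ o_E/p_E} Σ_{b ∈ p_F^{−n}/p_F^{2−n}} π(u(a, b√ε − aā/2)·ζ)v. -/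

import Mathlib

set_option autoImplicit false

open MeasureTheory Matrix

noncomputable section

/-- The 3×3 antidiagonal matrix `J`. -/
def J3mat (E : Type) [Field E] : Matrix (Fin 3) (Fin 3) E := !![0, 0, 1; 0, 1, 0; 1, 0, 0]

/-- `G = U(2,1)(E/F) = {g ∈ GL₃(E) : ᵗḡ J g = J}`. -/
def GUset {E : Type} [Field E] (σ : E → E) : Set (Matrix (Fin 3) (Fin 3) E) :=
  {g | (g.map σ)ᵀ * J3mat E * g = J3mat E}

/-- The upper unipotent element `u(x,y)`. -/
def uM {E : Type} [Field E] (σ : E → E) (x y : E) : Matrix (Fin 3) (Fin 3) E :=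
  !![1, x, y; 0, 1, -σ x; 0, 0, 1]

/-- The lower unipotent element `û(x,y)`. -/
def uhatM {E : Type} [Field E] (σ : E → E) (x y : E) : Matrix (Fin 3) (Fin 3) E :=
  !![1, 0, 0; x, 1, 0; y, -σ x, 1]

/-- The open compact subgroup `K_n` of `G`. -/
def KUset {E : Type} [Field E] (q : ℝ) (σ : E → E) (absE : E → ℝ) (n : ℤ) :
    Set (Matrix (Fin 3) (Fin 3) E) :=
  {g | g ∈ GUset σ ∧ absE (g 0 0) ≤ 1 ∧ absE (g 0 1) ≤ 1 ∧ absE (g 0 2) ≤ (q ^ 2) ^ n ∧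
    absE (g 1 0) ≤ (q ^ 2) ^ (-n) ∧ absE (g 1 1 - 1) ≤ (q ^ 2) ^ (-n) ∧ absE (g 1 2) ≤ 1 ∧
    absE (g 2 0) ≤ (q ^ 2) ^ (-n) ∧ absE (g 2 1) ≤ (q ^ 2) ^ (-n) ∧ absE (g 2 2) ≤ 1}

/-- The element `t_n`, antidiagonal `(ϖ^{-n}, 1, ϖ^n)`. -/
def tUmat {E : Type} [Field E] (piE : E) (n : ℤ) : Matrix (Fin 3) (Fin 3) E :=
  !![0, 0, piE ^ (-n); 0, 1, 0; piE ^ n, 0, 0]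

/-- The element `ζ = diag(ϖ, 1, ϖ⁻¹)`. -/
def zUmat {E : Type} [Field E] (piE : E) : Matrix (Fin 3) (Fin 3) E :=
  !![piE, 0, 0; 0, 1, 0; 0, 0, piE⁻¹]

/-- The element `ζ⁻¹ = diag(ϖ⁻¹, 1, ϖ)`. -/
def zUinv {E : Type} [Field E] (piE : E) : Matrix (Fin 3) (Fin 3) E :=
  !![piE⁻¹, 0, 0; 0, 1, 0; 0, 0, piE]

/-- The congruence subgroup `Z_m` of the center `Z ≃ E^1` of `G`. -/
def ZUset {E : Type} [Field E] (q : ℝ) (σ : E → E) (absE : E → ℝ) (m : ℤ) :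
    Set (Matrix (Fin 3) (Fin 3) E) :=
  {c | ∃ z : E, z * σ z = 1 ∧ absE (z - 1) ≤ (q ^ 2) ^ (-m) ∧
    c = z • (1 : Matrix (Fin 3) (Fin 3) E)}

/-- `r : ι → E` is a complete set of representatives for `p_E^m / p_E^{m'}`. -/
def RepsE {E : Type} [Field E] (q : ℝ) (absE : E → ℝ) (m m' : ℤ) {ι : Type} (r : ι → E) : Prop :=
  (∀ i, absE (r i) ≤ (q ^ 2) ^ (-m)) ∧
  (∀ i j, absE (r i - r j) ≤ (q ^ 2) ^ (-m') → i = j) ∧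
  (∀ x : E, absE x ≤ (q ^ 2) ^ (-m) → ∃ i, absE (x - r i) ≤ (q ^ 2) ^ (-m'))

/-- `r : ι → F` is a complete set of representatives for `p_F^m / p_F^{m'}`. -/
def RepsF {F : Type} [Field F] (q : ℝ) (absF : F → ℝ) (m m' : ℤ) {ι : Type} (r : ι → F) : Prop :=
  (∀ i, absF (r i) ≤ q ^ (-m)) ∧
  (∀ i j, absF (r i - r j) ≤ q ^ (-m') → i = j) ∧
  (∀ x : F, absF x ≤ q ^ (-m) → ∃ i, absF (x - r i) ≤ q ^ (-m'))

/-- `r : ι → G` is a complete set of representatives for the left coset space `K/K₀`: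
its members lie in `K`, in pairwise distinct left cosets of `K₀`, and every left coset
of `K₀` in `K` contains one of them. -/
def IsCompleteReps {E : Type} [Field E] {ι : Type}
    (K K₀ : Set (Matrix (Fin 3) (Fin 3) E)) (r : ι → Matrix (Fin 3) (Fin 3) E) : Prop :=
  (∀ i, r i ∈ K) ∧
  (∀ i j, (∃ c ∈ K₀, r i * c = r j) → i = j) ∧
  (∀ g ∈ K, ∃ i, ∃ c ∈ K₀, g = r i * c)

theorem reps_equiv {K : Type} [AddCommGroup K] (a : K → ℝ)
    (hneg : ∀ x, a (-x) = a x) (hadd : ∀ x y, a (x + y) ≤ max (a x) (a y))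
    (A B : ℝ) {ι κ : Type} (r : ι → K) (s : κ → K)
    (hr1 : ∀ i, a (r i) ≤ A) (hr2 : ∀ i j, a (r i - r j) ≤ B → i = j)
    (hr3 : ∀ x, a x ≤ A → ∃ i, a (x - r i) ≤ B)
    (hs1 : ∀ i, a (s i) ≤ A) (hs2 : ∀ i j, a (s i - s j) ≤ B → i = j)
    (hs3 : ∀ x, a x ≤ A → ∃ i, a (x - s i) ≤ B) :
    ∃ e : ι ≃ κ, ∀ i, a (r i - s (e i)) ≤ B := by
  choose f hf using fun i => hs3 (r i) (hr1 i)
  refine ⟨Equiv.ofBijective f ⟨?_, ?_⟩, hf⟩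
  · intro i j hij
    apply hr2
    have : r i - r j = (r i - s (f i)) + -(r j - s (f j)) := by rw [hij]; abel
    rw [this]
    refine (hadd _ _).trans (max_le (hf i) ?_)
    rw [hneg]; exact hf j
  · intro k
    obtain ⟨i, hi⟩ := hr3 (s k) (hs1 k)
    refine ⟨i, hs2 _ _ ?_⟩
    have : s (f i) - s k = -(r i - s (f i)) + -(s k - r i) := by abel
    rw [this]
    refine (hadd _ _).trans (max_le ?_ ?_)
    · rw [hneg]; exact hf i
    · rw [hneg]; exact hi

theorem GU_mul {E : Type} [Field E] (σ : E →+* E) {g h : Matrix (Fin 3) (Fin 3) E}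
    (hg : g ∈ GUset σ) (hh : h ∈ GUset σ) : g * h ∈ GUset σ := by
  change _ = _ at hg hh ⊢
  have e : (g * h).map σ = g.map σ * h.map σ := Matrix.map_mul
  rw [e, Matrix.transpose_mul]
  calc (h.map σ)ᵀ * (g.map σ)ᵀ * J3mat E * (g * h)
      = (h.map σ)ᵀ * ((g.map σ)ᵀ * J3mat E * g) * h := by simp only [Matrix.mul_assoc]
    _ = _ := by rw [hg, hh]

theorem uhat_mem {E : Type} [Field E] (σ : E →+* E) (hinv : ∀ x, σ (σ x) = x) (x y : E)
    (h : y + σ y + x * σ x = 0) : uhatM σ x y ∈ GUset σ := by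
  change _ = _
  ext i j
  fin_cases i <;> fin_cases j <;>
    simp [uhatM, J3mat, Matrix.mul_apply, Fin.sum_univ_three, hinv]
  linear_combination h

theorem t_mem {E : Type} [Field E] (σ : E →+* E) (P : E) (hP : P ≠ 0) (h : σ P = P) (n : ℤ) :
    tUmat P n ∈ GUset σ := by
  change _ = _
  ext i j
  fin_cases i <;> fin_cases j <;>
    simp [tUmat, J3mat, Matrix.mul_apply, Fin.sum_univ_three, h]
  · exact mul_inv_cancel₀ (zpow_ne_zero _ hP)
  · exact inv_mul_cancel₀ (zpow_ne_zero _ hP)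

theorem zinv_mem {E : Type} [Field E] (σ : E →+* E) (P : E) (hP : P ≠ 0) (h : σ P = P) :
    zUinv P ∈ GUset σ := by
  change _ = _
  ext i j
  fin_cases i <;> fin_cases j <;>
    simp [zUinv, J3mat, Matrix.mul_apply, Fin.sum_univ_three, h, hP]

theorem uhat_mul {E : Type} [Field E] (σ : E →+* E) (x y d r : E) :
    uhatM σ x y * uhatM σ d r = uhatM σ (x + d) (y + r - σ x * d) := by
  ext i j
  fin_cases i <;> fin_cases j <;>
    simp [uhatM, Matrix.mul_apply, Fin.sum_univ_three] <;> ring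

theorem key_mul {E : Type} [Field E] (σ : E →+* E) (hinv : ∀ x, σ (σ x) = x)
    (P : E) (hP : P ≠ 0) (h : σ P = P) (n : ℤ) (y s : E) :
    tUmat P n * uM σ y s * zUmat P =
      zUinv P * (uhatM σ (-(P ^ (n - 1) * σ y)) ((P ^ (n - 1)) ^ 2 * s) * tUmat P n) := by
  have e : P ^ n = P ^ (n - 1) * P := by rw [← zpow_add_one₀ hP]; simp
  have e' : P ^ (n - 1) ≠ 0 := zpow_ne_zero _ hP
  ext i j
  fin_cases i <;> fin_cases j <;>
    simp [tUmat, uM, zUmat, zUinv, uhatM, Matrix.mul_apply, Fin.sum_univ_three, hinv, h, _root_.zpow_neg, e] <;>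
    field_simp

/-- Explicit description of the Hecke operator: `Tv = π(ζ⁻¹) v' + Σ π(u(a, b√ε - aā/2) ζ) v`. -/
theorem stmt_15
    (F : Type) [Field F] [CharZero F]
    (q : ℝ) (hq : 1 < q)
    (absF : F → ℝ)
    (habsF0 : ∀ x : F, absF x = 0 ↔ x = 0)
    (habsFmul : ∀ x y : F, absF (x * y) = absF x * absF y)
    (habsFadd : ∀ x y : F, absF (x + y) ≤ max (absF x) (absF y))
    (ϖ : F) (hϖ : absF ϖ = q⁻¹)
    (hvalF : ∀ x : F, x ≠ 0 → ∃ m : ℤ, absF x = q ^ m)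
    (habsF2 : absF 2 = 1)
    (E : Type) [Field E] [Algebra F E]
    (σ : E → E)
    (hσadd : ∀ x y : E, σ (x + y) = σ x + σ y)
    (hσmul : ∀ x y : E, σ (x * y) = σ x * σ y)
    (hσinvol : ∀ x : E, σ (σ x) = x)
    (hσfix : ∀ x : F, σ (algebraMap F E x) = algebraMap F E x)
    (ε : F) (sqrtε : E)
    (hεabs : absF ε = 1)
    (hεnonsq : ∀ a : F, a * a ≠ ε)
    (hsqrtε : sqrtε * sqrtε = algebraMap F E ε)
    (hσsqrtε : σ sqrtε = -sqrtε)
    (hspan : ∀ x : E, ∃ a b : F, x = algebraMap F E a + algebraMap F E b * sqrtε)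
    (absE : E → ℝ)
    (habsE0 : ∀ x : E, absE x = 0 ↔ x = 0)
    (habsEmul : ∀ x y : E, absE (x * y) = absE x * absE y)
    (habsEadd : ∀ x y : E, absE (x + y) ≤ max (absE x) (absE y))
    (habsEF : ∀ x : F, absE (algebraMap F E x) = absF x ^ 2)
    (habsEconj : ∀ x : E, absE (σ x) = absE x)
    (habsEspan : ∀ a b : F,
      absE (algebraMap F E a + algebraMap F E b * sqrtε) = max (absF a ^ 2) (absF b ^ 2))
    (hvalE : ∀ x : E, x ≠ 0 → ∃ m : ℤ, absE x = (q ^ 2) ^ m)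
    (n : ℤ) (hn : 1 ≤ n)
    (ι₁ ι₂ ι₃ ι₄ ι₅ : Type) [Fintype ι₁] [Fintype ι₂] [Fintype ι₃] [Fintype ι₄] [Fintype ι₅]
    (yr : ι₁ → E) (hyr : RepsE q absE 0 1 yr)
    (zr : ι₂ → F) (hzr : RepsF q absF (1 - n) (2 - n) zr)
    (br : ι₃ → F) (hbr : RepsF q absF (-n) (2 - n) br)
    (wr : ι₄ → E) (hwr : RepsE q absE (n - 1) n wr)
    (cr : ι₅ → F) (hcr : RepsF q absF (n - 1) n cr)
    (V : Type) [AddCommGroup V] [Module ℂ V]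
    (ρ : Matrix (Fin 3) (Fin 3) E → Module.End ℂ V)
    (hρone : ρ 1 = 1)
    (hρmul : ∀ g ∈ GUset σ, ∀ h ∈ GUset σ, ρ (g * h) = ρ g * ρ h)
    (hρunit : ∀ g ∈ GUset σ, IsUnit (ρ g))
    (v : V) (hv : ∀ k ∈ KUset q σ absE n, ρ k v = v) :
    ((∑ p : ι₁ × ι₂, ρ (tUmat (algebraMap F E ϖ) n *
        uM σ (yr p.1) (algebraMap F E (zr p.2) * sqrtε - yr p.1 * σ (yr p.1) / 2) *
        zUmat (algebraMap F E ϖ)) v) +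
      ∑ p : ι₁ × ι₃, ρ (uM σ (yr p.1)
        (algebraMap F E (br p.2) * sqrtε - yr p.1 * σ (yr p.1) / 2) *
        zUmat (algebraMap F E ϖ)) v)
    = ρ (zUinv (algebraMap F E ϖ))
        (∑ p : ι₄ × ι₅, ρ (uhatM σ (wr p.1)
          (algebraMap F E (cr p.2) * sqrtε - wr p.1 * σ (wr p.1) / 2)) v) +
      ∑ p : ι₁ × ι₃, ρ (uM σ (yr p.1)
        (algebraMap F E (br p.2) * sqrtε - yr p.1 * σ (yr p.1) / 2) *
        zUmat (algebraMap F E ϖ)) v := by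
  obtain ⟨s, rfl⟩ : ∃ s : E →+* E, σ = ⇑s :=
    ⟨{ toFun := σ
       map_one' := by simpa using hσfix 1
       map_zero' := by simpa using hσfix 0
       map_add' := hσadd
       map_mul' := hσmul }, rfl⟩
  have hq0 : 0 < q := by linarith
  have hQ1 : 1 < q ^ 2 := by nlinarith
  have hQ0 : 0 < q ^ 2 := by positivity
  have hFnn : ∀ x, 0 ≤ absF x := by
    intro x
    by_cases hx : x = 0
    · rw [(habsF0 x).2 hx]
    · obtain ⟨m, hm⟩ := hvalF x hx
      rw [hm]; positivity
  have hEnn : ∀ x, 0 ≤ absE x := by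
    intro x
    by_cases hx : x = 0
    · rw [(habsE0 x).2 hx]
    · obtain ⟨m, hm⟩ := hvalE x hx
      rw [hm]; positivity
  have hF1 : absF 1 = 1 := by
    have h1 := habsFmul 1 1
    have h2 : absF 1 ≠ 0 := fun h => one_ne_zero ((habsF0 1).1 h)
    rw [mul_one] at h1
    exact (mul_left_cancel₀ h2 (by rw [mul_one]; exact h1)).symm
  have hE1 : absE 1 = 1 := by
    have := habsEF 1
    rw [map_one, hF1] at this
    simpa using this
  have hFm1 : absF (-1) = 1 := by
    have h1 := habsFmul (-1) (-1)
    rw [neg_mul_neg, mul_one, hF1] at h1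
    nlinarith [hFnn (-1)]
  have hEm1 : absE (-1) = 1 := by
    have := habsEF (-1)
    rw [map_neg, map_one, hFm1] at this
    simpa using this
  have hFneg : ∀ x, absF (-x) = absF x := by
    intro x
    rw [← neg_one_mul, habsFmul, hFm1, one_mul]
  have hEneg : ∀ x, absE (-x) = absE x := by
    intro x
    rw [← neg_one_mul, habsEmul, hEm1, one_mul]
  have hE2 : absE 2 = 1 := by
    have := habsEF 2
    rw [habsF2, map_ofNat] at this
    simpa using this
  have hϖ0 : ϖ ≠ 0 := by
    intro h
    rw [(habsF0 ϖ).2 h] at hϖ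
    have : 0 < q⁻¹ := by positivity
    linarith
  have h2F : (2 : F) ≠ 0 := two_ne_zero
  have h2E : (2 : E) ≠ 0 := by
    rw [← map_ofNat (algebraMap F E) 2]
    exact (map_ne_zero _).2 h2F
  have hFpow : ∀ m : ℤ, absF (ϖ ^ m) = q ^ (-m) := by
    let f : F →*₀ ℝ :=
      { toFun := absF, map_zero' := (habsF0 0).2 rfl, map_one' := hF1, map_mul' := habsFmul }
    intro m
    have : f (ϖ ^ m) = f ϖ ^ m := map_zpow₀ f ϖ m
    change absF (ϖ ^ m) = absF ϖ ^ m at this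
    rw [this, hϖ, _root_.inv_zpow, _root_.zpow_neg]
  set P : E := algebraMap F E ϖ with hPdef
  have hP0 : P ≠ 0 := by simpa [hPdef] using hϖ0
  have hsP : s P = P := hσfix ϖ
  have hEpow : ∀ m : ℤ, absE (P ^ m) = (q ^ 2) ^ (-m) := by
    intro m
    rw [hPdef, ← map_zpow₀, habsEF, hFpow, ← _root_.zpow_natCast, ← _root_.zpow_natCast, ← _root_.zpow_mul, ← _root_.zpow_mul,
      mul_comm]
  -- the two reindexing equivalences
  obtain ⟨e₁, he₁⟩ := reps_equiv absE hEneg habsEadd ((q ^ 2) ^ (-(n - 1))) ((q ^ 2) ^ (-n))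
    (fun i => -(P ^ (n - 1) * s (yr i))) wr
    (by
      intro i
      have := hyr.1 i
      rw [neg_zero, zpow_zero] at this
      simp only [hEneg, habsEmul, habsEconj, hEpow]
      exact mul_le_of_le_one_right (by positivity) this)
    (by
      intro i j hij
      apply hyr.2.1
      have e : -(P ^ (n - 1) * s (yr i)) - -(P ^ (n - 1) * s (yr j))
          = -(P ^ (n - 1) * s (yr i - yr j)) := by rw [map_sub]; ring
      simp only [e, hEneg, habsEmul, habsEconj, hEpow] at hij
      rw [show -n = -(n - 1) + -1 by ring, zpow_add₀ hQ0.ne'] at hij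
      exact le_of_mul_le_mul_left hij (by positivity))
    (by
      intro x hx
      obtain ⟨i, hi⟩ := hyr.2.2 (-(P ^ (-(n - 1)) * s x)) (by
        rw [hEneg, habsEmul, habsEconj, hEpow]
        calc _ ≤ (q ^ 2) ^ (- -(n - 1)) * (q ^ 2) ^ (-(n - 1)) := by gcongr
          _ = (q ^ 2) ^ (-0 : ℤ) := by rw [← zpow_add₀ hQ0.ne']; congr 1; ring)
      refine ⟨i, ?_⟩
      have e : x - -(P ^ (n - 1) * s (yr i))
          = -(P ^ (n - 1) * s (-(P ^ (-(n - 1)) * s x) - yr i)) := by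
        have : P ^ (n - 1) ≠ 0 := zpow_ne_zero _ hP0
        simp only [map_sub, map_neg, map_mul, map_zpow₀, hsP, hσinvol, _root_.zpow_neg, map_inv₀]
        field_simp
        ring
      simp only [e, hEneg, habsEmul, habsEconj, hEpow]
      rw [show -n = -(n - 1) + -1 by ring, zpow_add₀ hQ0.ne']
      gcongr)
    hwr.1 hwr.2.1 hwr.2.2
  obtain ⟨e₂, he₂⟩ := reps_equiv absF hFneg habsFadd (q ^ (-(n - 1))) (q ^ (-n))
    (fun i => ϖ ^ (2 * (n - 1)) * zr i) cr
    (by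
      intro i
      have := hzr.1 i
      simp only [habsFmul, hFpow]
      rw [show -(n - 1) = -(2 * (n - 1)) + -(1 - n) by ring, zpow_add₀ hq0.ne']
      gcongr)
    (by
      intro i j hij
      apply hzr.2.1
      simp only [← mul_sub, habsFmul, hFpow] at hij
      rw [show -n = -(2 * (n - 1)) + -(2 - n) by ring, zpow_add₀ hq0.ne'] at hij
      exact le_of_mul_le_mul_left hij (by positivity))
    (by
      intro x hx
      obtain ⟨i, hi⟩ := hzr.2.2 (ϖ ^ (-(2 * (n - 1))) * x) (by
        rw [habsFmul, hFpow]
        calc _ ≤ q ^ (- -(2 * (n - 1))) * q ^ (-(n - 1)) := by gcongr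
          _ = q ^ (-(1 - n)) := by rw [← zpow_add₀ hq0.ne']; congr 1; ring)
      refine ⟨i, ?_⟩
      have e : x - ϖ ^ (2 * (n - 1)) * zr i
          = ϖ ^ (2 * (n - 1)) * (ϖ ^ (-(2 * (n - 1))) * x - zr i) := by
        have : ϖ ^ (2 * (n - 1)) ≠ 0 := zpow_ne_zero _ hϖ0
        rw [_root_.zpow_neg]
        field_simp
      simp only [e, habsFmul, hFpow]
      rw [show -n = -(2 * (n - 1)) + -(2 - n) by ring, zpow_add₀ hq0.ne']
      gcongr)
    hcr.1 hcr.2.1 hcr.2.2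
  congr 1
  rw [map_sum]
  refine Fintype.sum_equiv (e₁.prodCongr e₂) _ _ ?_
  rintro ⟨i, k⟩
  simp only [Equiv.prodCongr_apply, Prod.map_apply]
  have hδ := he₁ i
  have hγ := he₂ k
  have hw := hwr.1 (e₁ i)
  rw [key_mul s hσinvol P hP0 hsP]
  set w := wr (e₁ i)
  set c := cr (e₂ k)
  set y := yr i
  set z := zr k
  set δ := -(P ^ (n - 1) * s y) - w with hδdef
  set γ := ϖ ^ (2 * (n - 1)) * z - c with hγdef
  set r : E := algebraMap F E γ * sqrtε + (s w * δ - w * s δ - δ * s δ) / 2 with hrdef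
  have hs2 : s 2 = 2 := map_ofNat s 2
  have hfac : uhatM s (-(P ^ (n - 1) * s y))
      ((P ^ (n - 1)) ^ 2 * (algebraMap F E z * sqrtε - y * s y / 2))
      = uhatM s w (algebraMap F E c * sqrtε - w * s w / 2) * uhatM s δ r := by
    rw [uhat_mul]
    congr 1
    · rw [hδdef]; ring
    · have e2 : algebraMap F E γ = (P ^ (n - 1)) ^ 2 * algebraMap F E z - algebraMap F E c := by
        rw [hγdef, map_sub, map_mul, map_zpow₀, mul_comm 2 (n - 1), _root_.zpow_mul, zpow_ofNat]
      rw [hrdef, e2, hδdef]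
      simp only [map_sub, map_neg, map_mul, map_zpow₀, hsP, hσinvol]
      field_simp
      ring
  have hu1 : uhatM s w (algebraMap F E c * sqrtε - w * s w / 2) ∈ GUset s := by
    apply uhat_mem s hσinvol
    simp only [map_sub, map_mul, map_div₀, hσfix, hσsqrtε, hσinvol, hs2]
    field_simp
    ring
  have hu2 : uhatM s δ r ∈ GUset s := by
    apply uhat_mem s hσinvol
    simp only [hrdef, map_add, map_sub, map_mul, map_div₀, hσfix, hσsqrtε, hσinvol, hs2]
    field_simp
    ring
  have ht : tUmat P n ∈ GUset s := t_mem s P hP0 hsP n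
  have hz : zUinv P ∈ GUset s := zinv_mem s P hP0 hsP
  have hw1 : absE w ≤ 1 := hw.trans (zpow_le_one_of_nonpos₀ hQ1.le (by linarith))
  have hn1 : (q ^ 2) ^ (-n) ≤ 1 := zpow_le_one_of_nonpos₀ hQ1.le (by linarith)
  have hδ1 : absE δ ≤ 1 := hδ.trans hn1
  have hr : absE r ≤ (q ^ 2) ^ (-n) := by
    have hmul : ∀ a b : E, absE a ≤ 1 → absE b ≤ (q ^ 2) ^ (-n) →
        absE (a * b) ≤ (q ^ 2) ^ (-n) := by
      intro a b ha hb
      rw [habsEmul]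
      exact (mul_le_of_le_one_left (hEnn b) ha).trans hb
    have hsub : ∀ a b : E, absE a ≤ (q ^ 2) ^ (-n) → absE b ≤ (q ^ 2) ^ (-n) →
        absE (a - b) ≤ (q ^ 2) ^ (-n) := by
      intro a b ha hb
      rw [sub_eq_add_neg]
      refine (habsEadd _ _).trans (max_le ha ?_)
      rwa [hEneg]
    refine (habsEadd _ _).trans (max_le ?_ ?_)
    · have := habsEspan 0 γ
      rw [map_zero, zero_add, (habsF0 0).2 rfl] at this
      rw [this]
      refine max_le (by rw [zero_pow two_ne_zero]; positivity) ?_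
      calc absF γ ^ 2 ≤ (q ^ (-n)) ^ 2 := by
            have := hFnn γ
            gcongr
        _ = _ := by
          rw [← _root_.zpow_natCast, ← _root_.zpow_natCast, ← _root_.zpow_mul, ← _root_.zpow_mul, mul_comm]
    · have e : absE ((s w * δ - w * s δ - δ * s δ) / 2) = absE (s w * δ - w * s δ - δ * s δ) := by
        conv_rhs => rw [← div_mul_cancel₀ (s w * δ - w * s δ - δ * s δ) h2E, habsEmul, hE2, mul_one]
      rw [e]
      have hsδ : absE (s δ) ≤ (q ^ 2) ^ (-n) := by rw [habsEconj]; exact hδ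
      exact hsub _ _ (hsub _ _ (hmul _ _ (by rw [habsEconj]; exact hw1) hδ) (hmul _ _ hw1 hsδ))
        (hmul _ _ hδ1 hsδ)
  have hE00 : absE 0 = 0 := (habsE0 0).2 rfl
  have hQn : 0 ≤ (q ^ 2) ^ (-n) := by positivity
  have hQn' : 0 ≤ (q ^ 2) ^ n := by positivity
  have hu2K : uhatM s δ r ∈ KUset q s absE n := by
    refine ⟨hu2, ?_⟩
    simp [uhatM, hE00, hE1, hEneg, habsEconj, - _root_.zpow_neg, hQn, hQn', hδ, hr]
  have htK : tUmat P n ∈ KUset q s absE n := by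
    refine ⟨ht, ?_⟩
    simp [tUmat, hE00, hE1, hEpow, - _root_.zpow_neg, hQn]
  rw [hfac, hρmul _ hz _ (GU_mul s (GU_mul s hu1 hu2) ht), hρmul _ (GU_mul s hu1 hu2) _ ht,
    hρmul _ hu1 _ hu2]
  simp only [Module.End.mul_apply]
  rw [hv _ htK, hv _ hu2K]
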